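/- arXiv:1211.6032 — 2 statements merged into one kernel-verified Lean document; each statement's English description precedes it below -/
import Mathlib

section
/- Let H₁, H₂, H₃ be complex Hilbert spaces, and let T : H₁ → H₂ and S : H₂ → H₃ be closed, densely defined (possibly unbounded) linear operators such that T(Dom T) ⊆ Dom S and S(Tζ) = 0 for all ζ ∈ Dom T. Suppose there exists a constant C > 0 such that ‖Sζ‖² + ‖T*ζ‖² ≥ C‖ζ‖² for all ζ ∈ Dom S ∩ Dom T*, where T* denotes the Hilbert space adjoint of T. Then for every Ψ in the orthogonal complement of ker T in H₁ there exists Ξ ∈ Dom T* with T*Ξ = Ψ and ‖Ξ‖² ≤ (1/C)·‖Ψ‖². In particular, the range of T* is closed. -/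
open LinearPMap in
theorem aux_mem_adj {H₁ H₂ : Type*}
    [NormedAddCommGroup H₁] [InnerProductSpace ℂ H₁] [CompleteSpace H₁]
    [NormedAddCommGroup H₂] [InnerProductSpace ℂ H₂]
    (T : H₁ →ₗ.[ℂ] H₂) (hT : Dense (T.domain : Set H₁)) (ζ : H₂) (ψ : H₁) :
    (ζ, ψ) ∈ T.adjoint.graph ↔ ∀ x : T.domain, inner ℂ ψ (x : H₁) = inner ℂ ζ (T x) := by
  constructor
  · intro h x
    rw [LinearPMap.mem_graph_iff] at h
    obtain ⟨y, h1, h2⟩ := h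
    simp only at h1 h2
    rw [← h1, ← h2]
    exact adjoint_isFormalAdjoint hT y x
  · intro h
    rw [LinearPMap.mem_graph_iff]
    exact ⟨⟨ζ, mem_adjoint_domain_of_exists _ ⟨ψ, h⟩⟩, rfl, adjoint_apply_eq hT _ h⟩

/-- For a closed densely defined operator, a vector orthogonal to the range of the adjoint
lies in the kernel. -/
theorem aux_ker {H₁ H₂ : Type*}
    [NormedAddCommGroup H₁] [InnerProductSpace ℂ H₁] [CompleteSpace H₁]
    [NormedAddCommGroup H₂] [InnerProductSpace ℂ H₂] [CompleteSpace H₂]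
    (T : H₁ →ₗ.[ℂ] H₂) (hT : Dense (T.domain : Set H₁)) (hc : T.IsClosed) (x : H₁)
    (hx : ∀ ζ ψ, (ζ, ψ) ∈ T.adjoint.graph → inner ℂ ψ x = 0) :
    (x, (0 : H₂)) ∈ T.graph := by
  let e := WithLp.prodContinuousLinearEquiv 2 ℂ H₁ H₂
  let G : Submodule ℂ (WithLp 2 (H₁ × H₂)) := T.graph.comap e.toLinearEquiv.toLinearMap
  have hG : IsClosed (G : Set (WithLp 2 (H₁ × H₂))) := by
    have h1 : IsClosed (T.graph : Set (H₁ × H₂)) := hc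
    exact h1.preimage e.continuous
  have : CompleteSpace G := hG.completeSpace_coe
  have key : WithLp.toLp 2 (x, (0 : H₂)) ∈ Gᗮᗮ := by
    rw [Submodule.mem_orthogonal]
    intro u hu
    rw [Submodule.mem_orthogonal'] at hu
    have h1 : (u.ofLp.2, - u.ofLp.1) ∈ T.adjoint.graph := by
      rw [aux_mem_adj T hT]
      intro y
      have h2 := hu (WithLp.toLp 2 ((y : H₁), T y)) (T.mem_graph y)
      rw [WithLp.prod_inner_apply] at h2
      simp only at h2
      rw [inner_neg_left]
      linear_combination -h2
    have h3 := hx _ _ h1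
    rw [inner_neg_left] at h3
    rw [WithLp.prod_inner_apply]
    simp only [inner_zero_right]
    linear_combination -h3
  rw [Submodule.orthogonal_orthogonal] at key
  exact key

/-- **Hörmander's existence theorem, adjoint version.**
Under the same a priori estimate, every `Ψ ∈ (ker T)ᗮ` is of the form `T*Ξ` with
`‖Ξ‖² ≤ (1/C)‖Ψ‖²`; in particular the range of `T*` is closed. -/
theorem index_thm_quasi_tori_stmt1
    {H₁ H₂ H₃ : Type*}
    [NormedAddCommGroup H₁] [InnerProductSpace ℂ H₁] [CompleteSpace H₁]
    [NormedAddCommGroup H₂] [InnerProductSpace ℂ H₂] [CompleteSpace H₂]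
    [NormedAddCommGroup H₃] [InnerProductSpace ℂ H₃] [CompleteSpace H₃]
    (T : H₁ →ₗ.[ℂ] H₂) (S : H₂ →ₗ.[ℂ] H₃)
    (hT_dense : Dense (T.domain : Set H₁)) (hT_closed : T.IsClosed)
    (hS_dense : Dense (S.domain : Set H₂)) (hS_closed : S.IsClosed)
    (hST : ∀ ζ : T.domain, ∃ h : (T ζ : H₂) ∈ S.domain, S ⟨T ζ, h⟩ = 0)
    (C : ℝ) (hC : 0 < C)
    (hest : ∀ (ζ : H₂) (hζS : ζ ∈ S.domain) (hζT : ζ ∈ T.adjoint.domain),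
      C * ‖ζ‖ ^ 2 ≤ ‖S ⟨ζ, hζS⟩‖ ^ 2 + ‖T.adjoint ⟨ζ, hζT⟩‖ ^ 2) :
    (∀ Ψ : H₁, Ψ ∈ ((LinearMap.ker T.toFun).map T.domain.subtype)ᗮ →
      ∃ Ξ : T.adjoint.domain, (T.adjoint Ξ : H₁) = Ψ ∧
        ‖(Ξ : H₂)‖ ^ 2 ≤ (1 / C) * ‖Ψ‖ ^ 2)
    ∧ IsClosed {Ψ : H₁ | ∃ Ξ : T.adjoint.domain, (T.adjoint Ξ : H₁) = Ψ} := by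
  -- the closure of the range of `T`
  let N : Submodule ℂ H₂ := (LinearMap.range T.toFun).topologicalClosure
  have hNc : IsClosed (N : Set H₂) := Submodule.isClosed_topologicalClosure _
  have hTN : ∀ x : T.domain, T x ∈ N := fun x =>
    Submodule.le_topologicalClosure _ ⟨x, rfl⟩
  have : CompleteSpace N := hNc.completeSpace_coe
  -- `N` lies in the kernel of `S`
  have hNS : ∀ ζ ∈ N, (ζ, (0 : H₃)) ∈ S.graph := by
    have hcl : IsClosed {ζ : H₂ | (ζ, (0 : H₃)) ∈ S.graph} := by
      have h1 : IsClosed (S.graph : Set (H₂ × H₃)) := hS_closed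
      exact h1.preimage (by fun_prop : Continuous fun ζ : H₂ => (ζ, (0 : H₃)))
    intro ζ hζ
    have hsub : ((LinearMap.range T.toFun : Submodule ℂ H₂) : Set H₂) ⊆
        {ζ : H₂ | (ζ, (0 : H₃)) ∈ S.graph} := by
      rintro _ ⟨x, rfl⟩
      obtain ⟨h, h0⟩ := hST x
      exact (LinearPMap.mem_graph_iff _).2 ⟨⟨T x, h⟩, rfl, h0⟩
    exact closure_minimal hsub hcl hζ
  -- the estimate on `N`
  have hN : ∀ ζ ∈ N, ∀ ψ, (ζ, ψ) ∈ T.adjoint.graph → C * ‖ζ‖ ^ 2 ≤ ‖ψ‖ ^ 2 := by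
    intro ζ hζ ψ hψ
    obtain ⟨⟨y, hy⟩, h1, h2⟩ := (LinearPMap.mem_graph_iff _).1 hψ
    obtain ⟨⟨z, hz⟩, h3, h4⟩ := (LinearPMap.mem_graph_iff _).1 (hNS ζ hζ)
    simp only at h1 h2 h3 h4
    subst h1
    subst h3
    have h5 := hest z hz hy
    rw [h4, h2] at h5
    simpa using h5
  -- projecting to `N`
  have hproj : ∀ ζ ψ, (ζ, ψ) ∈ T.adjoint.graph →
      ∃ ξ ∈ N, (ξ, ψ) ∈ T.adjoint.graph := by
    intro ζ ψ h
    refine ⟨N.starProjection ζ, Submodule.starProjection_apply_mem _ _, ?_⟩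
    rw [aux_mem_adj T hT_dense] at h ⊢
    intro x
    have h6 := Submodule.starProjection_inner_eq_zero (K := N) ζ (T x) (hTN x)
    rw [inner_sub_left] at h6
    rw [h x]
    linear_combination h6
  -- the range of the adjoint
  let G : Submodule ℂ (H₂ × H₁) := T.adjoint.graph ⊓ N.comap (LinearMap.fst ℂ H₂ H₁)
  have hGc : IsClosed (G : Set (H₂ × H₁)) := by
    have h1 : IsClosed (T.adjoint.graph : Set (H₂ × H₁)) :=
      LinearPMap.adjoint_isClosed hT_dense
    exact h1.inter (hNc.preimage continuous_fst)
  have : CompleteSpace G := hGc.completeSpace_coe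
  let f : G →L[ℂ] H₁ := (ContinuousLinearMap.snd ℂ H₂ H₁).comp G.subtypeL
  have hf : AntilipschitzWith (Real.toNNReal (1 + 1 / C)) f := by
    refine AddMonoidHomClass.antilipschitz_of_bound f ?_
    rintro ⟨⟨ζ, ψ⟩, hg, hζ⟩
    have hC' : 0 < 1 / C := by positivity
    rw [Real.coe_toNNReal _ (by positivity)]
    change ‖(ζ, ψ)‖ ≤ (1 + 1 / C) * ‖ψ‖
    have hb := hN ζ hζ ψ hg
    rw [Prod.norm_def]
    refine max_le ?_ ?_
    · change ‖ζ‖ ≤ _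
      refine (sq_le_sq₀ (norm_nonneg _) (by positivity)).1 ?_
      have h1 : ‖ζ‖ ^ 2 ≤ 1 / C * ‖ψ‖ ^ 2 := by
        rw [one_div, ← div_eq_inv_mul, le_div_iff₀ hC]
        linarith
      have h2 : 0 ≤ ‖ψ‖ ^ 2 := by positivity
      nlinarith [mul_nonneg hC'.le h2, mul_nonneg (mul_nonneg hC'.le hC'.le) h2]
    · change ‖ψ‖ ≤ _
      nlinarith [norm_nonneg ψ, mul_nonneg hC'.le (norm_nonneg ψ)]
  have hrc : IsClosed (Set.range f) := hf.isClosed_range f.uniformContinuous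
  have hmem : ∀ ψ, ψ ∈ Set.range f ↔ ∃ ξ ∈ N, (ξ, ψ) ∈ T.adjoint.graph := by
    intro ψ
    constructor
    · rintro ⟨⟨⟨ζ, ψ'⟩, hg, hζ⟩, rfl⟩
      exact ⟨ζ, hζ, hg⟩
    · rintro ⟨ξ, h1, h2⟩
      exact ⟨⟨(ξ, ψ), h2, h1⟩, rfl⟩
  refine ⟨?_, ?_⟩
  · intro Ψ hΨ
    let R : Submodule ℂ H₁ := LinearMap.range f.toLinearMap
    have hRc : IsClosed (R : Set H₁) := hrc
    have : CompleteSpace R := hRc.completeSpace_coe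
    have hR : Ψ ∈ Rᗮᗮ := by
      rw [Submodule.mem_orthogonal] at hΨ ⊢
      intro u hu
      apply hΨ
      rw [Submodule.mem_orthogonal] at hu
      have hk : (u, (0 : H₂)) ∈ T.graph := by
        refine aux_ker T hT_dense hT_closed u fun ζ ψ h => hu ψ ?_
        exact (hmem ψ).2 (hproj ζ ψ h)
      obtain ⟨y, h1, h2⟩ := (LinearPMap.mem_graph_iff _).1 hk
      exact ⟨y, h2, h1⟩
    rw [Submodule.orthogonal_orthogonal] at hR
    obtain ⟨ξ, h1, h2⟩ := (hmem Ψ).1 hR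
    have hb := hN ξ h1 Ψ h2
    obtain ⟨y, h3, h4⟩ := (LinearPMap.mem_graph_iff _).1 h2
    refine ⟨y, h4, ?_⟩
    simp only at h3
    rw [h3, one_div, ← div_eq_inv_mul, le_div_iff₀ hC]
    linarith
  · convert hrc using 1
    ext Ψ
    rw [hmem]
    constructor
    · rintro ⟨Ξ, rfl⟩
      exact hproj _ _ (T.adjoint.mem_graph Ξ)
    · rintro ⟨ξ, -, h⟩
      obtain ⟨y, -, h4⟩ := (LinearPMap.mem_graph_iff _).1 h
      exact ⟨y, h4⟩
end

section
/- Let 0 < m < n. Let Γ' ⊆ ℂⁿ be the ℤ-span of the standard basis vectors e₁,…,e_{n−m} of ℂ^{n−m} × {0}, and let Γ'' ⊆ ℂⁿ be a subgroup such that the projection p̃(u,v) = v maps Γ'' bijectively onto a lattice Λ of ℂ^m (a discrete subgroup of rank 2m whose ℝ-span is ℂ^m). Let Γ = Γ' ⊕ Γ'' (internal direct sum of subgroups of ℂⁿ). Let {f_γ}_{γ∈Γ} be a family of holomorphic functions ℂ^{n−m} → ℂ satisfying: (i) the cocycle condition f_{γ+γ'}(u) = f_{γ'}(u + u_γ) +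 f_γ(u) for all γ, γ' ∈ Γ and u ∈ ℂ^{n−m}, where u_γ is the E-component of γ; (ii) f_{γ'} ≡ 0 for every γ' ∈ Γ'; (iii) f_γ(u + u_{γ'}) = f_γ(u) for every γ ∈ Γ, γ' ∈ Γ' and u ∈ ℂ^{n−m}. Then there exists a function ℏ : ℂⁿ → ℂ that is smooth (C^∞ as a function of the 2n underlying real variables), is holomorphic along the fibre directions (for every fixed v ∈ ℂ^m, the map u ↦ ℏ(u,v) is holomorphic on ℂ^{n−m}), and satisfies ℏ(z + γ) − ℏ(z) = f_γ(u) for all γ ∈ Γ and all z = (u,v) ∈ ℂⁿ. -/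
open Metric Set Function in
lemma qt_fderiv_bound {k : ℕ} {f : (Fin k → ℂ) → ℂ} (hf : Differentiable ℂ f) (R : ℝ) :
    ∃ C : ℝ, ∀ x ∈ closedBall (0 : Fin k → ℂ) R, ‖fderiv ℂ f x‖ ≤ C := by
  obtain ⟨C, hC⟩ := (isCompact_closedBall (0 : Fin k → ℂ) (R + 1)).exists_bound_of_continuousOn
    hf.continuous.continuousOn
  refine ⟨max C 0, fun x hx => ?_⟩
  refine ContinuousLinearMap.opNorm_le_of_unit_norm (le_max_right _ _) fun y hy => ?_
  have h1 : HasDerivAt (fun t : ℂ => f (x + t • y)) (fderiv ℂ f x y) 0 := by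
    have h2 : HasDerivAt (fun t : ℂ => x + t • y) y 0 := by
      simpa using ((hasDerivAt_id (0 : ℂ)).smul_const y).const_add x
    have h3 : HasFDerivAt f (fderiv ℂ f x) (x + (0 : ℂ) • y) := by
      simpa using (hf x).hasFDerivAt
    exact h3.comp_hasDerivAt (0 : ℂ) h2
  rw [← h1.deriv]
  have h4 : Differentiable ℂ (fun t : ℂ => f (x + t • y)) := by fun_prop
  have := Complex.norm_deriv_le_of_forall_mem_sphere_norm_le (c := 0) (R := 1) (C := max C 0)
    one_pos h4.diffContOnCl (fun z hz => ?_)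
  · simpa using this
  · refine (hC _ ?_).trans (le_max_left _ _)
    rw [mem_closedBall_zero_iff] at hx ⊢
    rw [mem_sphere_zero_iff_norm] at hz
    refine (norm_add_le _ _).trans ?_
    rw [norm_smul, hz, hy]; linarith

open Metric Set Function MeasureTheory in
lemma qt_fderiv_differentiable {k : ℕ} {f : (Fin k → ℂ) → ℂ} (hf : Differentiable ℂ f)
    (y : Fin k → ℂ) : Differentiable ℂ (fun x => fderiv ℂ f x y) := by
  have key : ∀ x, fderiv ℂ f x y = (2 * Real.pi * Complex.I)⁻¹ •
      ∫ θ in (0 : ℝ)..(2 * Real.pi), (deriv (circleMap 0 1) θ * ((circleMap 0 1 θ) ^ 2)⁻¹) *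
        f (x + circleMap 0 1 θ • y) := by
    intro x
    have h1 : HasDerivAt (fun t : ℂ => f (x + t • y)) (fderiv ℂ f x y) 0 := by
      have h2 : HasDerivAt (fun t : ℂ => x + t • y) y 0 := by
        simpa using ((hasDerivAt_id (0 : ℂ)).smul_const y).const_add x
      have h3 : HasFDerivAt f (fderiv ℂ f x) (x + (0 : ℂ) • y) := by
        simpa using (hf x).hasFDerivAt
      exact h3.comp_hasDerivAt (0 : ℂ) h2
    have h4 : Differentiable ℂ (fun t : ℂ => f (x + t • y)) := by fun_prop
    rw [← h1.deriv, ← Complex.two_pi_I_inv_smul_circleIntegral_sub_sq_inv_smul_of_differentiable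
      isOpen_univ (c := 0) (R := 1) (subset_univ _) h4.differentiableOn
      (mem_ball_self one_pos)]
    simp only [circleIntegral, sub_zero, smul_eq_mul, mul_assoc]
  have hc : Continuous (fun θ : ℝ => deriv (circleMap 0 1) θ * ((circleMap 0 1 θ) ^ 2)⁻¹) := by
    simp only [deriv_circleMap]
    refine ((continuous_circleMap 0 1).mul continuous_const).mul
      (((continuous_circleMap 0 1).pow 2).inv₀ fun θ => ?_)
    exact pow_ne_zero _ (circleMap_ne_center one_ne_zero)
  have hcn : ∀ θ : ℝ, ‖deriv (circleMap 0 1) θ * ((circleMap 0 1 θ) ^ 2)⁻¹‖ = 1 := by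
    intro θ; simp [deriv_circleMap]
  have hcm := continuous_circleMap (0 : ℂ) 1
  rw [show (fun x => fderiv ℂ f x y) = _ from funext key]
  intro x₀
  refine DifferentiableAt.const_smul (R := ℂ) ?_ _
  obtain ⟨C, hC⟩ := qt_fderiv_bound hf (‖x₀‖ + 1 + ‖y‖)
  have hfc := hf.continuous
  refine (intervalIntegral.hasFDerivAt_integral_of_dominated_of_fderiv_le
    (F := fun x θ => (deriv (circleMap 0 1) θ * ((circleMap 0 1 θ) ^ 2)⁻¹) *
        f (x + circleMap 0 1 θ • y))
    (F' := fun x θ => (deriv (circleMap 0 1) θ * ((circleMap 0 1 θ) ^ 2)⁻¹) •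
        fderiv ℂ f (x + circleMap 0 1 θ • y))
    (bound := fun _ => C) (s := ball x₀ 1) (ball_mem_nhds _ one_pos)
    ?_ ?_ ?_ ?_ ?_ ?_).differentiableAt
  · refine Filter.Eventually.of_forall fun x => ?_
    exact (hc.mul (hfc.comp (by fun_prop))).aestronglyMeasurable
  · exact (hc.mul (hfc.comp (by fun_prop))).intervalIntegrable _ _
  · refine AEStronglyMeasurable.smul hc.aestronglyMeasurable ?_
    have : Measurable (fun θ : ℝ => fderiv ℂ f (x₀ + circleMap 0 1 θ • y)) :=
      (measurable_fderiv ℂ f).comp (Continuous.measurable (by fun_prop))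
    have : FiniteDimensional ℂ ((Fin k → ℂ) →L[ℂ] ℂ) := inferInstance
    have : ProperSpace ((Fin k → ℂ) →L[ℂ] ℂ) := FiniteDimensional.proper ℂ _
    exact Measurable.aestronglyMeasurable ‹_›
  · refine Filter.Eventually.of_forall fun θ _ x hx => ?_
    rw [norm_smul, hcn, one_mul]
    refine hC _ ?_
    rw [mem_closedBall_zero_iff]
    refine (norm_add_le _ _).trans ?_
    have h1 : ‖x‖ ≤ ‖x₀‖ + 1 := by
      have := norm_sub_norm_le x x₀
      rw [mem_ball, dist_eq_norm] at hx
      linarith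
    have h2 : ‖circleMap 0 1 θ • y‖ ≤ ‖y‖ := by
      rw [norm_smul]; simp
    linarith
  · exact intervalIntegrable_const
  · refine Filter.Eventually.of_forall fun θ _ x hx => ?_
    refine HasFDerivAt.const_mul ?_ _
    have := (hf (x + circleMap 0 1 θ • y)).hasFDerivAt
    exact (hasFDerivAt_comp_add_right _).2 this

lemma qt_contDiff_nat {k : ℕ} (N : ℕ) : ∀ {f : (Fin k → ℂ) → ℂ}, Differentiable ℂ f →
    ContDiff ℂ N f := by
  induction N with
  | zero => intro f hf; exact contDiff_zero.2 hf.continuous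
  | succ N ih =>
    intro f hf
    push_cast
    rw [contDiff_succ_iff_fderiv_apply]
    refine ⟨hf, fun h => ?_, fun y => ih (qt_fderiv_differentiable hf y)⟩
    exact absurd h (by simp)

lemma qt_contDiff {k : ℕ} {f : (Fin k → ℂ) → ℂ} (hf : Differentiable ℂ f) :
    ContDiff ℝ (⊤ : ℕ∞) f :=
  (contDiff_infty.2 fun N => qt_contDiff_nat N hf).restrict_scalars ℝ

open Metric Set Function in
lemma qt_partition {m : ℕ} (Λ : AddSubgroup (Fin m → ℂ))
    (hΛdisc : DiscreteTopology Λ)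
    (hΛspan : Submodule.span ℝ (Λ : Set (Fin m → ℂ)) = ⊤) :
    ∃ ρ : (Fin m → ℂ) → ℝ, ContDiff ℝ (⊤ : ℕ∞) ρ ∧
      (LocallyFinite fun l : Λ => support fun v => ρ (v + l)) ∧
      ∀ v, ∑ᶠ l : Λ, ρ (v + l) = 1 := by
  obtain ⟨R, hR0, hR⟩ : ∃ R : ℝ, 0 ≤ R ∧ ∀ v : Fin m → ℂ, ∃ l : Λ, ‖v + l‖ ≤ R := by
    let L : Submodule ℤ (Fin m → ℂ) := AddSubgroup.toIntSubmodule Λ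
    have : DiscreteTopology L := hΛdisc
    have : IsZLattice ℝ L := ⟨hΛspan⟩
    have : Module.Finite ℤ L := ZLattice.module_finite ℝ L
    have : Module.Free ℤ L := ZLattice.module_free ℝ L
    let b := Module.Free.chooseBasis ℤ L
    let B := b.ofZLatticeBasis ℝ L
    refine ⟨∑ i, ‖B i‖, by positivity, fun v => ?_⟩
    have h1 : (ZSpan.floor B v : Fin m → ℂ) ∈ L := by
      exact (b.ofZLatticeBasis_span ℝ L).le (ZSpan.floor B v).2
    refine ⟨⟨-(ZSpan.floor B v : Fin m → ℂ), Λ.neg_mem h1⟩, ?_⟩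
    have := ZSpan.norm_fract_le B v
    rwa [ZSpan.fract_apply, sub_eq_add_neg] at this
  let χ : ContDiffBump (0 : Fin m → ℂ) := ⟨R + 1, R + 2, by linarith, by linarith⟩
  have hfin : ∀ r : ℝ, {l : Λ | ‖(l : Fin m → ℂ)‖ ≤ r}.Finite := by
    intro r
    have hcl : IsClosed (Λ : Set (Fin m → ℂ)) := AddSubgroup.isClosed_of_discrete
    have := Metric.finite_isBounded_inter_isClosed (K := closedBall 0 r)
      (isDiscrete_iff_discreteTopology.2 hΛdisc) isBounded_closedBall hcl
    refine Finite.of_finite_image (f := Subtype.val) (this.subset ?_) Subtype.val_injective.injOn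
    rintro _ ⟨l, hl, rfl⟩
    exact ⟨by simpa using hl, l.2⟩
  have hlf : LocallyFinite fun l : Λ => support fun v => χ (v + l) := by
    intro v
    refine ⟨ball v 1, ball_mem_nhds _ one_pos, (hfin (R + 2 + ‖v‖ + 1)).subset ?_⟩
    rintro l ⟨w, hw1, hw2⟩
    have h1 : w + l ∈ support χ := hw1
    rw [χ.support_eq, mem_ball_zero_iff] at h1
    change ‖w + l‖ < R + 2 at h1
    rw [mem_ball, dist_eq_norm] at hw2
    have h2 := norm_sub_norm_le w v
    have h3 := norm_sub_le (w + (l : Fin m → ℂ)) w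
    rw [add_sub_cancel_left] at h3
    change ‖(l : Fin m → ℂ)‖ ≤ _
    linarith
  have hfs : ∀ v, (support fun l : Λ => χ (v + l)).Finite := fun v => hlf.point_finite v
  let S : (Fin m → ℂ) → ℝ := fun v => ∑ᶠ l : Λ, χ (v + l)
  have hS : ContDiff ℝ (⊤ : ℕ∞) S := by
    refine ContMDiff.contDiff (contMDiff_finsum (fun l => ?_) hlf)
    exact (χ.contDiff.comp (contDiff_id.add contDiff_const)).contMDiff
  have hSpos : ∀ v, 0 < S v := by
    intro v
    obtain ⟨l, hl⟩ := hR v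
    refine finsum_pos (fun _ => χ.nonneg) ⟨l, ?_⟩ (hfs v)
    refine χ.pos_of_mem_ball ?_
    rw [mem_ball_zero_iff]
    change _ < R + 2
    linarith
  have hSper : ∀ v (l : Λ), S (v + l) = S v := by
    intro v l
    have := finsum_comp_equiv (Equiv.addLeft l) (f := fun l' : Λ => χ (v + l'))
    simp only [S]
    rw [← this]
    refine finsum_congr fun i => ?_
    simp [add_assoc]
  refine ⟨fun v => χ v / S v, χ.contDiff.div hS fun v => (hSpos v).ne', ?_, fun v => ?_⟩
  · refine hlf.subset fun l v hv => ?_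
    simp only [mem_support] at hv ⊢
    intro h; simp [h] at hv
  · simp only [hSper, div_eq_mul_inv]
    rw [← finsum_mul]
    exact mul_inv_cancel₀ (hSpos v).ne'


/-- Existence of a smooth function `ℏ` on `ℂⁿ = ℂ^{n-m} × ℂ^m`, holomorphic along the fibre
directions, whose coboundary is a given additive cocycle `{f_γ}_{γ∈Γ}` of fibre-holomorphic
functions vanishing on `Γ'` and `Γ'`-periodic:
`ℏ(z + γ) - ℏ(z) = f_γ(u)` for all `γ ∈ Γ`, `z = (u,v)`. -/
theorem index_thm_quasi_tori_stmt9
    (n m : ℕ) (hm : 0 < m) (hmn : m < n)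
    (Γ' Γ'' Γ : AddSubgroup ((Fin (n - m) → ℂ) × (Fin m → ℂ)))
    (hΓ' : Γ' = AddSubgroup.closure
      (Set.range (fun i : Fin (n - m) =>
        (((Pi.single i 1 : Fin (n - m) → ℂ), (0 : Fin m → ℂ))
          : (Fin (n - m) → ℂ) × (Fin m → ℂ)))))
    (Λ : AddSubgroup (Fin m → ℂ))
    (hproj : Set.BijOn (fun z : (Fin (n - m) → ℂ) × (Fin m → ℂ) => z.2)
      (Γ'' : Set ((Fin (n - m) → ℂ) × (Fin m → ℂ))) (Λ : Set (Fin m → ℂ)))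
    (hΛdisc : DiscreteTopology Λ)
    (hΛspan : Submodule.span ℝ (Λ : Set (Fin m → ℂ)) = ⊤)
    (hΓsum : Γ = Γ' ⊔ Γ'') (hΓdisj : Γ' ⊓ Γ'' = ⊥)
    (f : ((Fin (n - m) → ℂ) × (Fin m → ℂ)) → (Fin (n - m) → ℂ) → ℂ)
    (hf_hol : ∀ g ∈ Γ, Differentiable ℂ (f g))
    (hf_cocycle : ∀ g ∈ Γ, ∀ g' ∈ Γ, ∀ u, f (g + g') u = f g' (u + g.1) + f g u)
    (hf_zero : ∀ g' ∈ Γ', ∀ u, f g' u = 0)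
    (hf_periodic : ∀ g ∈ Γ, ∀ g' ∈ Γ', ∀ u, f g (u + g'.1) = f g u) :
    ∃ ℏ : ((Fin (n - m) → ℂ) × (Fin m → ℂ)) → ℂ,
      ContDiff ℝ (⊤ : ℕ∞) ℏ
      ∧ (∀ v : Fin m → ℂ, Differentiable ℂ (fun u : Fin (n - m) → ℂ => ℏ (u, v)))
      ∧ (∀ g ∈ Γ, ∀ z : (Fin (n - m) → ℂ) × (Fin m → ℂ),
          ℏ (z + g) - ℏ z = f g z.1) := by
  obtain ⟨ρ, hρ, hlf, hsum⟩ := qt_partition Λ hΛdisc hΛspan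
  have hex : ∀ l : Λ, ∃ g ∈ Γ'', g.2 = (l : Fin m → ℂ) := fun l => hproj.surjOn l.2
  choose s hs hs2 using hex
  have hΓ'le : Γ' ≤ Γ := hΓsum ▸ le_sup_left
  have hΓ''le : Γ'' ≤ Γ := hΓsum ▸ le_sup_right
  have hΓ'2 : ∀ g ∈ Γ', g.2 = 0 := by
    intro g hg
    rw [hΓ'] at hg
    induction hg using AddSubgroup.closure_induction with
    | mem x hx => obtain ⟨i, rfl⟩ := hx; rfl
    | zero => rfl
    | add x y _ _ hx hy => simp [hx, hy]
    | neg x _ hx => simp [hx]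
  have hadd : ∀ l l' : Λ, s (l + l') = s l + s l' := by
    intro l l'
    refine hproj.injOn (hs _) (Γ''.add_mem (hs l) (hs l')) ?_
    simp [hs2]
  have hlf0 : ∀ v, (Function.support fun l : Λ => ρ (v + l)).Finite := fun v => hlf.point_finite v
  have hfinC : ∀ (v : Fin m → ℂ) (c : Λ → ℂ),
      (Function.support fun l : Λ => ((ρ (v + l) : ℝ) : ℂ) * c l).Finite := by
    intro v c
    refine (hlf0 v).subset fun l hl => ?_
    simp only [Function.mem_support] at hl ⊢
    intro h; simp [h] at hl
  have hsumC : ∀ v : Fin m → ℂ, ∑ᶠ l : Λ, ((ρ (v + l) : ℝ) : ℂ) = 1 := by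
    intro v
    have := (Complex.ofRealHom : ℝ →+* ℂ).toAddMonoidHom.map_finsum (hlf0 v)
    rw [hsum v] at this
    simpa using this.symm
  let H : ((Fin (n - m) → ℂ) × (Fin m → ℂ)) → ℂ :=
    fun z => -∑ᶠ l : Λ, ((ρ (z.2 + l) : ℝ) : ℂ) * f (s l) z.1
  have hH' : ∀ g ∈ Γ', ∀ z, H (z + g) - H z = f g z.1 := by
    intro g hg z
    simp only [H, Prod.snd_add, Prod.fst_add, hΓ'2 g hg, add_zero, hf_zero g hg,
      hf_periodic _ (hΓ''le (hs _)) g hg, sub_self]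
  have hH'' : ∀ g ∈ Γ'', ∀ z, H (z + g) - H z = f g z.1 := by
    intro g hg z
    obtain ⟨l, hl⟩ : ∃ l : Λ, s l = g := by
      refine ⟨⟨g.2, hproj.mapsTo hg⟩, hproj.injOn (hs _) hg ?_⟩
      simp [hs2]
    subst hl
    have h1 : ∑ᶠ i : Λ, ((ρ ((z + s l).2 + i) : ℝ) : ℂ) * f (s i) (z + s l).1
        = ∑ᶠ i : Λ, ((ρ (z.2 + i) : ℝ) : ℂ) * (f (s i) z.1 - f (s l) z.1) := by
      rw [← finsum_comp_equiv (Equiv.addLeft l)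
        (f := fun i : Λ => ((ρ (z.2 + i) : ℝ) : ℂ) * (f (s i) z.1 - f (s l) z.1))]
      refine finsum_congr fun i => ?_
      simp only [Equiv.coe_addLeft, hadd,
        hf_cocycle _ (hΓ''le (hs l)) _ (hΓ''le (hs i)), Prod.snd_add, Prod.fst_add, hs2,
        AddSubgroup.coe_add, add_assoc, add_sub_cancel_right]
    simp only [H]
    rw [h1]
    simp only [mul_sub]
    rw [finsum_sub_distrib (hfinC _ _) (hfinC _ _), ← finsum_mul, hsumC]
    ring
  refine ⟨H, ?_, fun v => ?_, ?_⟩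
  · refine ContDiff.neg (ContMDiff.contDiff (contMDiff_finsum (fun l => ?_) ?_))
    · refine ContDiff.contMDiff (ContDiff.mul ?_ ?_)
      · exact Complex.ofRealCLM.contDiff.comp (hρ.comp (contDiff_snd.add contDiff_const))
      · exact (qt_contDiff (hf_hol _ (hΓ''le (hs l)))).comp contDiff_fst
    · refine (hlf.preimage_continuous (g := Prod.snd) continuous_snd).subset fun l z hz => ?_
      simp only [Function.mem_support, Set.mem_preimage] at hz ⊢
      intro h; simp [h] at hz
  · have : (fun u => H (u, v)) = fun u => -∑ l ∈ (hlf0 v).toFinset,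
        ((ρ (v + l) : ℝ) : ℂ) * f (s l) u := by
      funext u
      simp only [H]
      congr 1
      refine finsum_eq_sum_of_support_subset _ fun l hl => ?_
      simp only [Function.mem_support, Set.Finite.coe_toFinset] at hl ⊢
      intro h; simp [h] at hl
    rw [this]
    refine Differentiable.neg (Differentiable.fun_sum fun l _ => ?_)
    exact (hf_hol _ (hΓ''le (hs l))).const_mul _
  · intro g hg z
    rw [hΓsum] at hg
    obtain ⟨a, ha, b, hb, rfl⟩ := AddSubgroup.mem_sup.1 hg
    rw [hf_cocycle a (hΓ'le ha) b (hΓ''le hb), ← hH' a ha z]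
    have := hH'' b hb (z + a)
    rw [Prod.fst_add] at this
    rw [← this, add_assoc]
    ring
end
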